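/- For every positive integer m, the number of fixed-point-free involutions in the symmetric group S_{2m} equals the sum, over all threshold partitions λ of 2m, of the number f^λ of standard Young tableaux of shape λ. -/

import Mathlib

/-- The weight of a semistandard Young tableau: `ssytWeight T i` is the number of cells of the
tableau whose entry equals `i`. -/
def ssytWeight {μ : YoungDiagram} (T : SemistandardYoungTableau μ) (i : ℕ) : ℕ :=
  (μ.cells.filter fun c => T c.1 c.2 = i).card

/-- `tabCard μ ν` is the number of semistandard Young tableaux of shape `μ` and weight `ν`,
where `ν : Fin n → ℕ`: the entry `j` (for `j < n`) occurs exactly `ν j` times, and no entry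
`≥ n` occurs. -/
noncomputable def tabCard (μ : YoungDiagram) {n : ℕ} (ν : Fin n → ℕ) : ℕ :=
  Set.ncard {T : SemistandardYoungTableau μ |
    ∀ j : ℕ, ssytWeight T j = if h : j < n then ν ⟨j, h⟩ else 0}

/-- The Schur polynomial `s_μ(x_0, …, x_{n-1})`, as the generating function of semistandard
Young tableaux of shape `μ` with entries in `{0, …, n-1}`. -/
noncomputable def schurPoly (n : ℕ) (μ : YoungDiagram) : MvPolynomial (Fin n) ℤ :=
  ∑ᶠ (T : SemistandardYoungTableau μ) (_ : ∀ c ∈ μ.cells, T c.1 c.2 < n),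
    ∏ i : Fin n, (MvPolynomial.X i : MvPolynomial (Fin n) ℤ) ^ ssytWeight T (i : ℕ)

/-- The number of odd rows (odd parts) of a Young diagram. -/
def oddRowsCount (lam : YoungDiagram) : ℕ :=
  lam.rowLens.countP fun r => r % 2 = 1

/-- The number of odd columns of a Young diagram. -/
def oddColsCount (lam : YoungDiagram) : ℕ :=
  oddRowsCount lam.transpose

/-- A Young diagram is a *threshold* partition if its Frobenius coordinates satisfy
`β i = α i + 1` for each `i` up to the Durfee rank; with 0-indexed diagrams this says that
`colLen i = rowLen i + 1` for each diagonal cell `(i, i)`. -/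
def YoungDiagram.IsThreshold (lam : YoungDiagram) : Prop :=
  ∀ i : ℕ, (i, i) ∈ lam → lam.colLen i = lam.rowLen i + 1

namespace YoungDiagram

theorem mk_lt_card {ν : YoungDiagram} {i j : ℕ} (h : (i, j) ∈ ν) : i < ν.card ∧ j < ν.card := by
  constructor
  · refine (mem_iff_lt_colLen.1 h).trans_le ?_
    rw [colLen_eq_card]
    exact Finset.card_le_card (Finset.filter_subset _ _)
  · refine (mem_iff_lt_rowLen.1 h).trans_le ?_
    rw [rowLen_eq_card]
    exact Finset.card_le_card (Finset.filter_subset _ _)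

theorem finite_card_eq (n : ℕ) : {ν : YoungDiagram | ν.card = n}.Finite := by
  refine (((Finset.range n ×ˢ Finset.range n).powerset.finite_toSet).preimage
    (f := YoungDiagram.cells) (fun a _ b _ h => YoungDiagram.ext h)).subset ?_
  rintro ν rfl
  simp only [Set.mem_preimage, Finset.mem_coe, Finset.mem_powerset]
  rintro ⟨i, j⟩ h
  simpa using mk_lt_card ((mem_cells _).1 h)

/-- The Young diagrams with `n` cells. -/
noncomputable def ofCard (n : ℕ) : Finset YoungDiagram :=
  (finite_card_eq n).toFinset

@[simp]
theorem mem_ofCard {n : ℕ} {ν : YoungDiagram} : ν ∈ ofCard n ↔ ν.card = n := by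
  simp [ofCard]

theorem exists_cells_eq_insert {ν : YoungDiagram} {c : ℕ × ℕ}
    (h₁ : ∀ i, c.1 = i + 1 → (i, c.2) ∈ ν) (h₂ : ∀ j, c.2 = j + 1 → (c.1, j) ∈ ν) :
    ∃ lam : YoungDiagram, lam.cells = insert c ν.cells := by
  refine ⟨⟨insert c ν.cells, ?_⟩, rfl⟩
  rintro ⟨i, j⟩ ⟨a, b⟩ ⟨hai, hbj⟩ h
  obtain ⟨k, l⟩ := c
  simp only [Finset.coe_insert, Set.mem_insert_iff, Finset.mem_coe, mem_cells,
    Prod.mk.injEq] at h hai hbj ⊢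
  rcases h with ⟨rfl, rfl⟩ | h
  · rcases hai.lt_or_eq with ha | rfl
    · obtain ⟨i, rfl⟩ : ∃ k, i = k + 1 := ⟨i - 1, by omega⟩
      exact Or.inr (ν.up_left_mem (by omega) hbj (h₁ i rfl))
    · rcases hbj.lt_or_eq with hb | rfl
      · obtain ⟨j, rfl⟩ : ∃ k, j = k + 1 := ⟨j - 1, by omega⟩
        exact Or.inr (ν.up_left_mem le_rfl (by omega) (h₂ j rfl))
      · exact Or.inl ⟨rfl, rfl⟩
  · exact Or.inr (ν.up_left_mem hai hbj h)

theorem exists_cells_eq_erase {ν : YoungDiagram} {c : ℕ × ℕ}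
    (h₁ : (c.1 + 1, c.2) ∉ ν) (h₂ : (c.1, c.2 + 1) ∉ ν) :
    ∃ κ : YoungDiagram, κ.cells = ν.cells.erase c := by
  refine ⟨⟨ν.cells.erase c, ?_⟩, rfl⟩
  rintro ⟨i, j⟩ ⟨a, b⟩ ⟨hai, hbj⟩ h
  obtain ⟨k, l⟩ := c
  simp only [Finset.coe_erase, Set.mem_sdiff, Finset.mem_coe, mem_cells, Set.mem_singleton_iff,
    Prod.mk.injEq] at h hai hbj h₁ h₂ ⊢
  refine ⟨ν.up_left_mem hai hbj h.1, ?_⟩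
  rintro ⟨rfl, rfl⟩
  rcases hai.lt_or_eq with ha | rfl
  · exact h₁ (ν.up_left_mem ha hbj h.1)
  · rcases hbj.lt_or_eq with hb | rfl
    · exact h₂ (ν.up_left_mem le_rfl hb h.1)
    · exact h.2 ⟨rfl, rfl⟩

theorem exists_insert_of_le {ν lam : YoungDiagram} (h : ν ≤ lam) (hc : lam.card = ν.card + 1) :
    ∃ c ∉ ν, lam.cells = insert c ν.cells := by
  obtain ⟨c, hc, h⟩ := Finset.exists_eq_insert_iff.2 ⟨cells_subset_iff.2 h, hc.symm⟩
  exact ⟨c, hc, h.symm⟩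

theorem mem_iff_of_cells_eq_insert {ν lam : YoungDiagram} {c : ℕ × ℕ}
    (h : lam.cells = insert c ν.cells) (d : ℕ × ℕ) : d ∈ lam ↔ d = c ∨ d ∈ ν := by
  rw [← mem_cells, h, Finset.mem_insert, mem_cells]

theorem mem_iff_of_cells_eq_erase {ν κ : YoungDiagram} {c : ℕ × ℕ}
    (h : κ.cells = ν.cells.erase c) (d : ℕ × ℕ) : d ∈ κ ↔ d ≠ c ∧ d ∈ ν := by
  rw [← mem_cells, h, Finset.mem_erase, mem_cells]

theorem le_and_card_of_cells_eq_insert {ν lam : YoungDiagram} {c : ℕ × ℕ} (hc : c ∉ ν)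
    (h : lam.cells = insert c ν.cells) : ν ≤ lam ∧ lam.card = ν.card + 1 :=
  ⟨cells_subset_iff.1 (h ▸ Finset.subset_insert _ _), by
    rw [YoungDiagram.card, h, Finset.card_insert_of_notMem (by simpa using hc)]⟩

theorem le_and_card_of_cells_eq_erase {ν κ : YoungDiagram} {c : ℕ × ℕ} (hc : c ∈ ν)
    (h : κ.cells = ν.cells.erase c) : κ ≤ ν ∧ ν.card = κ.card + 1 :=
  ⟨cells_subset_iff.1 (h ▸ Finset.erase_subset _ _), by
    rw [YoungDiagram.card, YoungDiagram.card, h, Finset.card_erase_add_one (by simpa using hc)]⟩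

/-- The fixed-point-free involution of the quarter plane exchanging the cell `(i, j)`, `i ≤ j`,
with `(j + 1, i)`. -/
def flip (c : ℕ × ℕ) : ℕ × ℕ :=
  if c.1 ≤ c.2 then (c.2 + 1, c.1) else (c.2, c.1 - 1)

theorem flip_flip (c : ℕ × ℕ) : flip (flip c) = c := by
  obtain ⟨i, j⟩ := c
  unfold flip
  grind

theorem flip_ne (c : ℕ × ℕ) : flip c ≠ c := by
  obtain ⟨i, j⟩ := c
  unfold flip
  grind

theorem isThreshold_iff_mk {lam : YoungDiagram} :
    lam.IsThreshold ↔ ∀ i j, i ≤ j → ((i, j) ∈ lam ↔ (j + 1, i) ∈ lam) := by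
  constructor
  · intro h i j hij
    by_cases hi : (i, i) ∈ lam
    · rw [mem_iff_lt_rowLen, mem_iff_lt_colLen, h i hi]
      omega
    · exact ⟨fun h' => absurd (lam.up_left_mem le_rfl hij h') hi,
        fun h' => absurd (lam.up_left_mem (by omega) le_rfl h') hi⟩
  · intro h i hi
    have h₁ := h i (lam.rowLen i)
    have h₂ := h i (lam.rowLen i - 1)
    rw [mem_iff_lt_rowLen, mem_iff_lt_colLen] at h₁ h₂
    rw [mem_iff_lt_rowLen] at hi
    grind

theorem isThreshold_iff_flip_mem {lam : YoungDiagram} :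
    lam.IsThreshold ↔ ∀ c ∈ lam, flip c ∈ lam := by
  rw [isThreshold_iff_mk]
  constructor
  · rintro h ⟨i, j⟩ hc
    unfold flip
    split_ifs with hij
    · exact (h i j hij).1 hc
    · obtain ⟨i, rfl⟩ : ∃ k, i = k + 1 := ⟨i - 1, by grind⟩
      exact (h j i (by grind)).2 hc
  · intro h i j hij
    have h₁ := h (i, j)
    have h₂ := h (j + 1, i)
    unfold flip at h₁ h₂
    grind

theorem IsThreshold.exists_le_of_le {ν lam : YoungDiagram} (hl : lam.IsThreshold) (h : ν ≤ lam)
    (hc : lam.card = ν.card + 1) : ∃ κ ≤ ν, ν.card = κ.card + 1 ∧ κ.IsThreshold := by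
  rw [isThreshold_iff_flip_mem] at hl
  obtain ⟨c, hcν, hins⟩ := exists_insert_of_le h hc
  have hmem := mem_iff_of_cells_eq_insert hins
  have hfc : flip c ∈ ν := by grind [flip_ne]
  have hcor : ∀ d ∈ lam, d ≠ c → ¬ c ≤ d := fun d hd hdc hcd =>
    hcν (ν.isLowerSet hcd (((hmem d).1 hd).resolve_left hdc))
  have key : ∀ d ∈ ν, (d = ((flip c).1 + 1, (flip c).2) ∨ d = ((flip c).1, (flip c).2 + 1)) →
      False := by
    intro d hd hd'
    have hdl := (hmem d).2 (Or.inr hd)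
    have hfd := hl d hdl
    obtain ⟨i, j⟩ := c
    have hii := hcor (i + 1, j)
    have hfl := hcor _ hfd
    have hfc' := (hmem _).2 (Or.inr hfc)
    simp only [flip, Prod.le_def] at *
    grind
  obtain ⟨κ, hκ⟩ := exists_cells_eq_erase (ν := ν) (c := flip c) (fun h => key _ h (Or.inl rfl))
    (fun h => key _ h (Or.inr rfl))
  obtain ⟨h₁, h₂⟩ := le_and_card_of_cells_eq_erase hfc hκ
  refine ⟨κ, h₁, h₂, isThreshold_iff_flip_mem.2 fun d hd => ?_⟩
  have hmem' := mem_iff_of_cells_eq_erase hκ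
  have := flip_flip d
  have := flip_flip c
  grind

theorem IsThreshold.exists_ge_of_le {κ ν : YoungDiagram} (hk : κ.IsThreshold) (h : κ ≤ ν)
    (hc : ν.card = κ.card + 1) : ∃ lam, ν ≤ lam ∧ lam.card = ν.card + 1 ∧ lam.IsThreshold := by
  rw [isThreshold_iff_flip_mem] at hk
  obtain ⟨c, hcκ, hins⟩ := exists_insert_of_le h hc
  have hmem := mem_iff_of_cells_eq_insert hins
  have hfc : flip c ∉ ν := by
    have := flip_flip c
    have := hk (flip c)
    grind [flip_ne]
  have hpred : ∀ d ≤ c, d ≠ c → d ∈ κ := fun d hd hdc =>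
    ((hmem d).1 (ν.isLowerSet hd ((hmem c).2 (Or.inl rfl)))).resolve_left hdc
  have key : ∀ d, (flip c = (d.1 + 1, d.2) ∨ flip c = (d.1, d.2 + 1)) → d ∈ ν := by
    intro d hd'
    rw [hmem]
    have hfd := hpred (flip d)
    have hfd' := hk (flip d)
    rw [flip_flip] at hfd'
    have hfc' := hpred (flip c)
    have hff := hk (flip c)
    rw [flip_flip] at hff
    obtain ⟨i, j⟩ := c
    obtain ⟨a, b⟩ := d
    simp only [flip, Prod.le_def] at *
    grind
  obtain ⟨lam, hl⟩ := exists_cells_eq_insert (ν := ν) (c := flip c)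
    (fun i hi => key _ (Or.inl (Prod.ext hi rfl))) (fun i hi => key _ (Or.inr (Prod.ext rfl hi)))
  obtain ⟨h₁, h₂⟩ := le_and_card_of_cells_eq_insert hfc hl
  refine ⟨lam, h₁, h₂, isThreshold_iff_flip_mem.2 fun d hd => ?_⟩
  have hmem' := mem_iff_of_cells_eq_insert hl
  have := flip_flip d
  have := flip_flip c
  grind

theorem IsThreshold.eq_of_ge {ν lam lam' : YoungDiagram} (hl : lam.IsThreshold)
    (hl' : lam'.IsThreshold) (h : ν ≤ lam) (h' : ν ≤ lam') (hc : lam.card = ν.card + 1)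
    (hc' : lam'.card = ν.card + 1) : lam = lam' := by
  rw [isThreshold_iff_flip_mem] at hl hl'
  obtain ⟨c, hcν, hins⟩ := exists_insert_of_le h hc
  obtain ⟨c', -, hins'⟩ := exists_insert_of_le h' hc'
  have hmem := mem_iff_of_cells_eq_insert hins
  have hmem' := mem_iff_of_cells_eq_insert hins'
  have hcc : c = c' := by grind [flip_ne, flip_flip]
  exact YoungDiagram.ext (by rw [hins, hins', hcc])

theorem IsThreshold.eq_of_le {ν κ κ' : YoungDiagram} (hk : κ.IsThreshold)
    (hk' : κ'.IsThreshold) (h : κ ≤ ν) (h' : κ' ≤ ν) (hc : ν.card = κ.card + 1)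
    (hc' : ν.card = κ'.card + 1) : κ = κ' := by
  rw [isThreshold_iff_flip_mem] at hk hk'
  obtain ⟨c, hcκ, hins⟩ := exists_insert_of_le h hc
  obtain ⟨c', hcκ', hins'⟩ := exists_insert_of_le h' hc'
  have hmem := mem_iff_of_cells_eq_insert hins
  have hmem' := mem_iff_of_cells_eq_insert hins'
  have hcc : c = c' := by grind [flip_ne, flip_flip]
  subst hcc
  refine YoungDiagram.ext (Finset.ext fun d => ?_)
  rw [mem_cells, mem_cells]
  grind

open Classical in
theorem card_isThreshold_ge_eq_card_isThreshold_le {n : ℕ} {ν : YoungDiagram}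
    (hν : ν.card = n + 1) :
    ({lam ∈ ofCard (n + 2) | lam.IsThreshold ∧ ν ≤ lam} : Finset _).card =
      ({κ ∈ ofCard n | κ.IsThreshold ∧ κ ≤ ν} : Finset _).card := by
  set A : Finset YoungDiagram := {lam ∈ ofCard (n + 2) | lam.IsThreshold ∧ ν ≤ lam} with hA
  set B : Finset YoungDiagram := {κ ∈ ofCard n | κ.IsThreshold ∧ κ ≤ ν} with hB
  have hA1 : A.card ≤ 1 := Finset.card_le_one.2 fun a ha b hb => by
    simp only [hA, Finset.mem_filter, mem_ofCard] at ha hb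
    exact ha.2.1.eq_of_ge hb.2.1 ha.2.2 hb.2.2 (by omega) (by omega)
  have hB1 : B.card ≤ 1 := Finset.card_le_one.2 fun a ha b hb => by
    simp only [hB, Finset.mem_filter, mem_ofCard] at ha hb
    exact ha.2.1.eq_of_le hb.2.1 ha.2.2 hb.2.2 (by omega) (by omega)
  have hAB : A.Nonempty ↔ B.Nonempty := by
    simp only [Finset.Nonempty, hA, hB, Finset.mem_filter, mem_ofCard]
    constructor
    · rintro ⟨lam, h1, h2, h3⟩
      obtain ⟨κ, h4, h5, h6⟩ := h2.exists_le_of_le h3 (by omega)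
      exact ⟨κ, by omega, h6, h4⟩
    · rintro ⟨κ, h1, h2, h3⟩
      obtain ⟨lam, h4, h5, h6⟩ := h2.exists_ge_of_le h3 (by omega)
      exact ⟨lam, by omega, h6, h4⟩
  rw [← Finset.card_pos, ← Finset.card_pos] at hAB
  omega

open Finset Classical in
theorem card_ge_eq_card_le_add_one {n : ℕ} {ν : YoungDiagram} (hν : ν.card = n + 1) :
    #{lam ∈ ofCard (n + 2) | ν ≤ lam} = #{κ ∈ ofCard n | κ ≤ ν} + 1 := by
  have hA : #{lam ∈ ofCard (n + 2) | ν ≤ lam} =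
      #{i ∈ range (n + 2) | ∀ k, i = k + 1 → ν.rowLen i < ν.rowLen k} := by
    have hcell : ∀ lam ∈ ({lam ∈ ofCard (n + 2) | ν ≤ lam} : Finset _),
        ∃ i, lam.cells = insert (i, ν.rowLen i) ν.cells ∧
          ∑ c ∈ lam.cells \ ν.cells, c.1 = i ∧ ∀ k, i = k + 1 → ν.rowLen i < ν.rowLen k := by
      intro lam hl
      simp only [mem_filter, mem_ofCard] at hl
      obtain ⟨⟨i, j⟩, hc, hins⟩ := exists_insert_of_le hl.2 (by omega)
      have hmem := mem_iff_of_cells_eq_insert hins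
      have hc' : (i, j) ∈ lam := (hmem _).2 (Or.inl rfl)
      have hj : j = ν.rowLen i := by
        rw [mem_iff_lt_rowLen] at hc
        by_contra hne
        have h₁ := lam.up_left_mem le_rfl (show ν.rowLen i ≤ j by omega) hc'
        rw [hmem, mem_iff_lt_rowLen] at h₁
        grind
      subst hj
      refine ⟨i, hins, ?_, ?_⟩
      · rw [hins, insert_sdiff_of_notMem _ (by simpa using hc), sdiff_self]
        simp
      · rintro k rfl
        have h₁ := lam.up_left_mem (show k ≤ k + 1 by omega) le_rfl hc'
        rw [hmem, mem_iff_lt_rowLen] at h₁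
        grind
    refine card_bij (fun lam _ => ∑ c ∈ lam.cells \ ν.cells, c.1) ?_ ?_ ?_
    · intro lam hl
      obtain ⟨i, hins, hi, hk⟩ := hcell lam hl
      rw [hi]
      simp only [mem_filter, mem_ofCard, mem_range] at hl ⊢
      refine ⟨?_, hk⟩
      have := mk_lt_card ((mem_iff_of_cells_eq_insert hins (i, ν.rowLen i)).2 (Or.inl rfl))
      omega
    · intro lam hl lam' hl' h
      obtain ⟨i, hins, hi, -⟩ := hcell lam hl
      obtain ⟨i', hins', hi', -⟩ := hcell lam' hl'
      simp only [hi, hi'] at h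
      subst h
      exact YoungDiagram.ext (hins.trans hins'.symm)
    · intro i hi
      simp only [mem_filter, mem_range] at hi
      obtain ⟨lam, hl⟩ := exists_cells_eq_insert (ν := ν) (c := (i, ν.rowLen i))
        (fun k hk => mem_iff_lt_rowLen.2 (hi.2 k hk))
        (fun j hj => mem_iff_lt_rowLen.2 (by change j < ν.rowLen i; simp only at hj; omega))
      have hc : (i, ν.rowLen i) ∉ ν := by rw [mem_iff_lt_rowLen]; omega
      obtain ⟨h₁, h₂⟩ := le_and_card_of_cells_eq_insert hc hl
      refine ⟨lam, by simp only [mem_filter, mem_ofCard]; exact ⟨by omega, h₁⟩, ?_⟩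
      rw [hl, insert_sdiff_of_notMem _ (by simpa using hc), sdiff_self]
      simp
  have hB : #{κ ∈ ofCard n | κ ≤ ν} = #{i ∈ range (n + 1) | ν.rowLen (i + 1) < ν.rowLen i} := by
    have hcell : ∀ κ ∈ ({κ ∈ ofCard n | κ ≤ ν} : Finset _),
        ∃ i, κ.cells = ν.cells.erase (i, ν.rowLen i - 1) ∧
          ∑ c ∈ ν.cells \ κ.cells, c.1 = i ∧ ν.rowLen (i + 1) < ν.rowLen i := by
      intro κ hk
      simp only [mem_filter, mem_ofCard] at hk
      obtain ⟨⟨i, j⟩, hc, hins⟩ := exists_insert_of_le hk.2 (by omega)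
      have hmem := mem_iff_of_cells_eq_insert hins
      have hc' : (i, j) ∈ ν := (hmem _).2 (Or.inl rfl)
      have hcκ : (i, j) ∉ κ.cells := by simpa using hc
      have h₁ : (i, j + 1) ∉ ν := fun h => by
        rw [hmem] at h
        exact hc (κ.up_left_mem le_rfl (Nat.le_succ j) (h.resolve_left (by simp)))
      have h₂ : (i + 1, j) ∉ ν := fun h => by
        rw [hmem] at h
        exact hc (κ.up_left_mem (Nat.le_succ i) le_rfl (h.resolve_left (by simp)))
      rw [mem_iff_lt_rowLen] at h₁ h₂ hc'
      obtain rfl : j = ν.rowLen i - 1 := by omega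
      refine ⟨i, ?_, ?_, by omega⟩
      · rw [hins, erase_insert hcκ]
      · rw [hins, insert_sdiff_of_notMem _ hcκ, sdiff_self]
        simp
    refine card_bij (fun κ _ => ∑ c ∈ ν.cells \ κ.cells, c.1) ?_ ?_ ?_
    · intro κ hk
      obtain ⟨i, hins, hi, hk⟩ := hcell κ hk
      rw [hi]
      simp only [mem_filter, mem_range]
      refine ⟨?_, hk⟩
      have : (i, 0) ∈ ν := mem_iff_lt_rowLen.2 (by omega)
      have := mk_lt_card this
      omega
    · intro κ hk κ' hk' h
      obtain ⟨i, hins, hi, -⟩ := hcell κ hk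
      obtain ⟨i', hins', hi', -⟩ := hcell κ' hk'
      simp only [hi, hi'] at h
      subst h
      exact YoungDiagram.ext (hins.trans hins'.symm)
    · intro i hi
      simp only [mem_filter, mem_range] at hi
      obtain ⟨κ, hk⟩ := exists_cells_eq_erase (ν := ν) (c := (i, ν.rowLen i - 1))
        (by rw [mem_iff_lt_rowLen]; simp only; omega) (by rw [mem_iff_lt_rowLen]; simp only; omega)
      have hc : (i, ν.rowLen i - 1) ∈ ν := by rw [mem_iff_lt_rowLen]; omega
      obtain ⟨h₁, h₂⟩ := le_and_card_of_cells_eq_erase hc hk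
      refine ⟨κ, by simp only [mem_filter, mem_ofCard]; exact ⟨by omega, h₁⟩, ?_⟩
      rw [hk, sdiff_erase ((mem_cells _).2 hc), sdiff_self]
      simp
  rw [hA, hB]
  have : ({i ∈ range (n + 2) | ∀ k, i = k + 1 → ν.rowLen i < ν.rowLen k} : Finset ℕ) =
      insert 0 (({i ∈ range (n + 1) | ν.rowLen (i + 1) < ν.rowLen i} : Finset ℕ).map
        (addRightEmbedding 1)) := by
    ext i
    rcases i with _ | i <;> simp
  rw [this, card_insert_of_notMem (by simp), card_map]

open Finset Classical in
theorem card_ge_ge_eq_card_le_le {n : ℕ} {μ ν : YoungDiagram} (hμ : μ.card = n + 1)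
    (hν : ν.card = n + 1) (hne : μ ≠ ν) :
    #{lam ∈ ofCard (n + 2) | ν ≤ lam ∧ μ ≤ lam} = #{κ ∈ ofCard n | κ ≤ ν ∧ κ ≤ μ} := by
  have eq_of_le : ∀ {a b : YoungDiagram}, a ≤ b → b.card ≤ a.card → a = b := fun h hc =>
    YoungDiagram.ext (eq_of_subset_of_card_le (cells_subset_iff.2 h) hc)
  have hcard : (ν ⊔ μ).card + (ν ⊓ μ).card = 2 * n + 2 := by
    have := card_union_add_card_inter ν.cells μ.cells
    simp only [YoungDiagram.card, cells_sup, cells_inf] at *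
    omega
  have hsup : n + 2 ≤ (ν ⊔ μ).card := by
    by_contra hlt
    exact hne ((eq_of_le le_sup_right (by omega)).trans (eq_of_le le_sup_left (by omega)).symm)
  have hA : ({lam ∈ ofCard (n + 2) | ν ≤ lam ∧ μ ≤ lam} : Finset _) =
      if (ν ⊔ μ).card = n + 2 then {ν ⊔ μ} else ∅ := by
    ext lam
    simp only [mem_filter, mem_ofCard, ← sup_le_iff]
    have hle : ν ⊔ μ ≤ lam → (ν ⊔ μ).card ≤ lam.card := fun h =>
      card_le_card (cells_subset_iff.2 h)
    split_ifs with h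
    · rw [mem_singleton]
      exact ⟨fun h' => (eq_of_le h'.2 (by omega)).symm, fun h' => by rw [h']; exact ⟨h, le_rfl⟩⟩
    · simp only [notMem_empty, iff_false]
      exact fun h' => h (le_antisymm (h'.1 ▸ hle h'.2) hsup)
  have hB : ({κ ∈ ofCard n | κ ≤ ν ∧ κ ≤ μ} : Finset _) =
      if (ν ⊔ μ).card = n + 2 then {ν ⊓ μ} else ∅ := by
    ext κ
    simp only [mem_filter, mem_ofCard, ← le_inf_iff]
    have hle : κ ≤ ν ⊓ μ → κ.card ≤ (ν ⊓ μ).card := fun h =>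
      card_le_card (cells_subset_iff.2 h)
    split_ifs with h
    · rw [mem_singleton]
      exact ⟨fun h' => eq_of_le h'.2 (by omega), fun h' => by rw [h']; exact ⟨by omega, le_rfl⟩⟩
    · simp only [notMem_empty, iff_false]
      exact fun h' => h (by have := hle h'.2; omega)
  rw [hA, hB]
  split_ifs <;> simp

open Finset Classical in
/-- A function on Young diagrams obeying the branching rule going down the Young lattice obeys the
branching rule going up. -/
theorem sum_ge_eq_of_sum_le {f : YoungDiagram → ℕ}
    (hf : ∀ n, ∀ lam ∈ ofCard (n + 1), f lam = ∑ κ ∈ ofCard n with κ ≤ lam, f κ) (n : ℕ) :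
    ∀ ν ∈ ofCard n, ∑ lam ∈ ofCard (n + 1) with ν ≤ lam, f lam = (n + 1) * f ν := by
  induction n with
  | zero =>
    intro ν hν
    have hbot : ∀ κ : YoungDiagram, κ.card = 0 ↔ κ = ⊥ := fun κ => by
      rw [YoungDiagram.card, card_eq_zero, YoungDiagram.ext_iff, cells_bot]
    have h0 : ofCard 0 = {⊥} := by ext κ; simp [hbot]
    obtain rfl : ν = ⊥ := by simpa [h0] using hν
    have h1 : ∃ a, ofCard 1 = {a} := by
      obtain ⟨a, ha⟩ := exists_cells_eq_insert (ν := ⊥) (c := (0, 0)) (by simp) (by simp)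
      have hac : a.card = 1 := by simp [YoungDiagram.card, ha]
      refine ⟨a, ?_⟩
      ext b
      simp only [mem_ofCard, mem_singleton]
      refine ⟨fun hb => ?_, fun hb => hb ▸ hac⟩
      refine YoungDiagram.ext (eq_of_subset_of_card_le ?_ (by
        change a.card ≤ b.card
        omega))
      rintro ⟨i, j⟩ hij
      have := mk_lt_card ((mem_cells _).1 hij)
      rw [ha]
      simp
      omega
    obtain ⟨a, ha⟩ := h1
    have := hf 0 a (by simp [ha])
    simp_all [filter_singleton]
  | succ n ih =>
    intro ν hν
    rw [mem_ofCard] at hν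
    have key : ∀ μ ∈ ofCard (n + 1), #{lam ∈ ofCard (n + 2) | ν ≤ lam ∧ μ ≤ lam} =
        #{κ ∈ ofCard n | κ ≤ ν ∧ κ ≤ μ} + if μ = ν then 1 else 0 := by
      intro μ hμ
      split_ifs with h
      · subst h
        simpa using card_ge_eq_card_le_add_one hν
      · exact card_ge_ge_eq_card_le_le (by simpa using hμ) hν h
    calc ∑ lam ∈ ofCard (n + 2) with ν ≤ lam, f lam
        = ∑ lam ∈ ofCard (n + 2) with ν ≤ lam, ∑ μ ∈ ofCard (n + 1) with μ ≤ lam, f μ :=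
          sum_congr rfl fun lam hl => hf _ _ (mem_filter.1 hl).1
      _ = ∑ μ ∈ ofCard (n + 1), #{lam ∈ ofCard (n + 2) | ν ≤ lam ∧ μ ≤ lam} * f μ := by
          simp_rw [sum_filter (s := ofCard (n + 1))]
          rw [sum_comm]
          refine sum_congr rfl fun μ _ => ?_
          rw [← sum_filter, filter_filter, sum_const, smul_eq_mul]
      _ = ∑ μ ∈ ofCard (n + 1), #{κ ∈ ofCard n | κ ≤ ν ∧ κ ≤ μ} * f μ + f ν := by
          rw [sum_congr rfl fun μ hμ => by rw [key μ hμ]]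
          simp_rw [add_mul]
          rw [sum_add_distrib]
          simp [ite_mul, hν]
      _ = ∑ κ ∈ ofCard n with κ ≤ ν, ∑ μ ∈ ofCard (n + 1) with κ ≤ μ, f μ + f ν := by
          simp_rw [sum_filter (s := ofCard (n + 1))]
          rw [sum_comm]
          congr 1
          refine sum_congr rfl fun μ _ => ?_
          rw [← sum_filter, filter_filter, sum_const, smul_eq_mul]
      _ = ∑ κ ∈ ofCard n with κ ≤ ν, (n + 1) * f κ + f ν := by
          rw [sum_congr rfl fun κ hκ => ih κ (mem_filter.1 hκ).1]
      _ = (n + 1 + 1) * f ν := by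
          rw [← mul_sum, ← hf n ν (by simpa using hν)]
          ring

open Finset Classical in
theorem sum_isThreshold_eq {f : YoungDiagram → ℕ}
    (hf : ∀ n, ∀ lam ∈ ofCard (n + 1), f lam = ∑ κ ∈ ofCard n with κ ≤ lam, f κ) (n : ℕ) :
    ∑ lam ∈ ofCard (n + 2) with lam.IsThreshold, f lam =
      (n + 1) * ∑ κ ∈ ofCard n with κ.IsThreshold, f κ := by
  calc ∑ lam ∈ ofCard (n + 2) with lam.IsThreshold, f lam
      = ∑ lam ∈ ofCard (n + 2) with lam.IsThreshold, ∑ ν ∈ ofCard (n + 1) with ν ≤ lam, f ν :=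
        sum_congr rfl fun lam hl => hf _ _ (mem_filter.1 hl).1
    _ = ∑ ν ∈ ofCard (n + 1), #{lam ∈ ofCard (n + 2) | lam.IsThreshold ∧ ν ≤ lam} * f ν := by
        simp_rw [sum_filter (s := ofCard (n + 1))]
        rw [sum_comm]
        refine sum_congr rfl fun μ _ => ?_
        rw [← sum_filter, filter_filter, sum_const, smul_eq_mul]
    _ = ∑ ν ∈ ofCard (n + 1), #{κ ∈ ofCard n | κ.IsThreshold ∧ κ ≤ ν} * f ν :=
        sum_congr rfl fun ν hν => by
          rw [card_isThreshold_ge_eq_card_isThreshold_le (mem_ofCard.1 hν)]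
    _ = ∑ κ ∈ ofCard n with κ.IsThreshold, ∑ ν ∈ ofCard (n + 1) with κ ≤ ν, f ν := by
        simp_rw [sum_filter (s := ofCard (n + 1))]
        rw [sum_comm]
        refine sum_congr rfl fun μ _ => ?_
        rw [← sum_filter, filter_filter, sum_const, smul_eq_mul]
    _ = (n + 1) * ∑ κ ∈ ofCard n with κ.IsThreshold, f κ := by
        rw [mul_sum]
        exact sum_congr rfl fun κ hκ => sum_ge_eq_of_sum_le hf n κ (mem_filter.1 hκ).1

end YoungDiagram

/-- The standard Young tableaux of shape `lam`, with entries `0, …, n - 1`. -/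
def standardTableaux (lam : YoungDiagram) (n : ℕ) : Set (SemistandardYoungTableau lam) :=
  {T | ∀ j, ssytWeight T j = if j < n then 1 else 0}

theorem tabCard_one (lam : YoungDiagram) (n : ℕ) :
    tabCard lam (fun _ : Fin n => 1) = (standardTableaux lam n).ncard := by
  simp [tabCard, standardTableaux]

theorem lt_of_mem_standardTableaux {lam : YoungDiagram} {n : ℕ} {T : SemistandardYoungTableau lam}
    (hT : T ∈ standardTableaux lam n) {i j : ℕ} (h : (i, j) ∈ lam) : T i j < n := by
  by_contra hlt
  have := hT (T i j)
  rw [if_neg hlt, ssytWeight, Finset.card_eq_zero, Finset.filter_eq_empty_iff] at this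
  exact this ((YoungDiagram.mem_cells _).2 h) rfl

theorem finite_standardTableaux (lam : YoungDiagram) (n : ℕ) : (standardTableaux lam n).Finite := by
  refine Set.Finite.of_injOn (f := fun T (c : lam.cells) => T c.1.1 c.1.2)
    (t := {g | ∀ c, g c ∈ Set.Iio n}) ?_ ?_ (Set.Finite.pi' fun _ => Set.finite_Iio n)
  · intro T hT c
    exact lt_of_mem_standardTableaux hT ((YoungDiagram.mem_cells _).1 c.2)
  · intro T _ T' _ h
    ext i j
    by_cases hc : (i, j) ∈ lam
    · exact congrFun h ⟨(i, j), hc⟩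
    · rw [T.zeros hc, T'.zeros hc]

namespace SemistandardYoungTableau

/-- The restriction of a tableau to a smaller shape. -/
def restrict {lam : YoungDiagram} (T : SemistandardYoungTableau lam) {κ : YoungDiagram}
    (h : κ ≤ lam) : SemistandardYoungTableau κ where
  entry i j := if (i, j) ∈ κ then T i j else 0
  row_weak' hj hc := by
    rw [if_pos hc, if_pos (κ.up_left_mem le_rfl hj.le hc)]
    exact T.row_weak hj (h hc)
  col_strict' hi hc := by
    rw [if_pos hc, if_pos (κ.up_left_mem hi.le le_rfl hc)]
    exact T.col_strict hi (h hc)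
  zeros' hc := if_neg hc

theorem restrict_apply {lam : YoungDiagram} (T : SemistandardYoungTableau lam) {κ : YoungDiagram}
    (h : κ ≤ lam) {i j : ℕ} (hc : (i, j) ∈ κ) : T.restrict h i j = T i j :=
  if_pos hc

/-- The extension of a tableau by one cell, with a new largest entry. -/
def extend {κ : YoungDiagram} (T : SemistandardYoungTableau κ) {lam : YoungDiagram} {c : ℕ × ℕ}
    (h : lam.cells = insert c κ.cells) (hc : c ∉ κ) {n : ℕ} (hT : ∀ i j, (i, j) ∈ κ → T i j < n) :
    SemistandardYoungTableau lam where
  entry i j := if (i, j) = c then n else T i j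
  row_weak' {i j1 j2} hj hmem := by
    rw [YoungDiagram.mem_iff_of_cells_eq_insert h] at hmem
    rcases hmem with rfl | hmem
    · rw [if_neg (by simp [hj.ne]), if_pos rfl]
      by_cases h' : (i, j1) ∈ κ
      · exact (hT _ _ h').le
      · simp [T.zeros h']
    · have := κ.up_left_mem le_rfl hj.le hmem
      rw [if_neg (ne_of_mem_of_not_mem this hc), if_neg (ne_of_mem_of_not_mem hmem hc)]
      exact T.row_weak hj hmem
  col_strict' {i1 i2 j} hi hmem := by
    have hup := lam.up_left_mem hi.le le_rfl hmem
    rw [YoungDiagram.mem_iff_of_cells_eq_insert h] at hmem hup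
    rcases hmem with rfl | hmem
    · rw [if_neg (by simp [hi.ne]), if_pos rfl]
      exact hT _ _ (hup.resolve_left (by simp [hi.ne]))
    · have := κ.up_left_mem hi.le le_rfl hmem
      rw [if_neg (ne_of_mem_of_not_mem this hc), if_neg (ne_of_mem_of_not_mem hmem hc)]
      exact T.col_strict hi hmem
  zeros' {i j} hmem := by
    rw [YoungDiagram.mem_iff_of_cells_eq_insert h, not_or] at hmem
    rw [if_neg hmem.1, T.zeros hmem.2]

theorem extend_apply {κ : YoungDiagram} (T : SemistandardYoungTableau κ) {lam : YoungDiagram}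
    {c : ℕ × ℕ} (h : lam.cells = insert c κ.cells) (hc : c ∉ κ) {n : ℕ}
    (hT : ∀ i j, (i, j) ∈ κ → T i j < n) (i j : ℕ) :
    T.extend h hc hT i j = if (i, j) = c then n else T i j :=
  rfl

end SemistandardYoungTableau

open SemistandardYoungTableau YoungDiagram

theorem ssytWeight_of_cells_eq_insert {κ lam : YoungDiagram} {c : ℕ × ℕ}
    {T : SemistandardYoungTableau κ} {T' : SemistandardYoungTableau lam}
    (h : lam.cells = insert c κ.cells) (hc : c ∉ κ)
    (hT : ∀ i j, (i, j) ∈ κ → T i j = T' i j) (k : ℕ) :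
    ssytWeight T' k = ssytWeight T k + if T' c.1 c.2 = k then 1 else 0 := by
  have h₁ : {d ∈ κ.cells | T' d.1 d.2 = k} = {d ∈ κ.cells | T d.1 d.2 = k} :=
    Finset.filter_congr fun d hd => by rw [hT d.1 d.2 hd]
  rw [ssytWeight, ssytWeight, h, Finset.filter_insert, h₁]
  split_ifs with hk
  · rw [Finset.card_insert_of_notMem (by simp [hc])]
  · rfl

theorem ncard_standardTableaux_fiber {n : ℕ} {κ lam : YoungDiagram} {c : ℕ × ℕ}
    (h : lam.cells = insert c κ.cells) (hc : c ∉ κ) :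
    {T ∈ standardTableaux lam (n + 1) | T c.1 c.2 = n}.ncard = (standardTableaux κ n).ncard := by
  have hle := (le_and_card_of_cells_eq_insert hc h).1
  have hmem := mem_iff_of_cells_eq_insert h
  refine Set.ncard_congr (fun T _ => T.restrict hle) ?_ ?_ ?_
  · rintro T ⟨hT, hTc⟩ k
    have h₁ := ssytWeight_of_cells_eq_insert h hc (fun i j hij => T.restrict_apply hle hij) k
    have h₂ := hT k
    rw [hTc] at h₁
    grind
  · rintro T T' ⟨hT, hTc⟩ ⟨hT', hTc'⟩ heq
    ext i j
    by_cases hij : (i, j) ∈ lam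
    · rcases (hmem _).1 hij with rfl | hij
      · exact hTc.trans hTc'.symm
      · rw [← T.restrict_apply hle hij, ← T'.restrict_apply hle hij, heq]
    · rw [T.zeros hij, T'.zeros hij]
  · intro T hT
    have hlt : ∀ i j, (i, j) ∈ κ → T i j < n := fun i j => lt_of_mem_standardTableaux hT
    have hTκ : ∀ i j, (i, j) ∈ κ → T i j = T.extend h hc hlt i j := fun i j hij => by
      rw [extend_apply, if_neg (ne_of_mem_of_not_mem hij hc)]
    have hTc : T.extend h hc hlt c.1 c.2 = n := by rw [extend_apply, if_pos rfl]
    refine ⟨T.extend h hc hlt, ⟨fun k => ?_, hTc⟩, ?_⟩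
    · rw [ssytWeight_of_cells_eq_insert h hc hTκ, hTc, hT k]
      grind
    · ext i j
      by_cases hij : (i, j) ∈ κ
      · rw [restrict_apply _ _ hij, hTκ i j hij]
      · rw [zeros _ hij, zeros _ hij]

open Finset Classical in
/-- The branching rule for the number of standard Young tableaux. -/
theorem ncard_standardTableaux_succ {n : ℕ} {lam : YoungDiagram} (hl : lam.card = n + 1) :
    (standardTableaux lam (n + 1)).ncard =
      ∑ κ ∈ ofCard n with κ ≤ lam, (standardTableaux κ n).ncard := by
  let F : YoungDiagram → Set (SemistandardYoungTableau lam) := fun κ =>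
    {T ∈ standardTableaux lam (n + 1) | ∀ c ∈ lam, c ∉ κ → T c.1 c.2 = n}
  have hF : ∀ κ ∈ ({κ ∈ ofCard n | κ ≤ lam} : Finset _),
      (F κ).ncard = (standardTableaux κ n).ncard := by
    intro κ hk
    simp only [mem_filter, mem_ofCard] at hk
    obtain ⟨c, hc, h⟩ := exists_insert_of_le hk.2 (by omega)
    rw [← ncard_standardTableaux_fiber h hc]
    have hmem := mem_iff_of_cells_eq_insert h
    congr 1
    ext T
    simp only [F, Set.mem_ofPred_eq, hmem]
    grind
  have huniq : ∀ T ∈ standardTableaux lam (n + 1), ∃ c ∈ lam, T c.1 c.2 = n ∧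
      ∀ d ∈ lam, T d.1 d.2 = n → d = c := by
    intro T hT
    have := hT n
    rw [if_pos n.lt_succ_self, ssytWeight, card_eq_one] at this
    obtain ⟨c, hc⟩ := this
    simp only [Finset.ext_iff, mem_filter, mem_singleton, mem_cells] at hc
    exact ⟨c, ((hc c).2 rfl).1, ((hc c).2 rfl).2, fun d hd hd' => (hc d).1 ⟨hd, hd'⟩⟩
  have hU : standardTableaux lam (n + 1) =
      ⋃ κ ∈ ({κ ∈ ofCard n | κ ≤ lam} : Finset _), F κ := by
    ext T
    simp only [Set.mem_iUnion, exists_prop]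
    refine ⟨fun hT => ?_, fun ⟨κ, _, hT⟩ => hT.1⟩
    obtain ⟨⟨i, j⟩, hc, hTc, hu⟩ := huniq T hT
    have hle : ∀ a b, (a, b) ∈ lam → T a b ≤ n := fun a b hab =>
      Nat.lt_succ_iff.1 (lt_of_mem_standardTableaux hT hab)
    obtain ⟨κ, hκ⟩ := exists_cells_eq_erase (ν := lam) (c := (i, j))
      (fun h => by
        have h₁ := T.col_strict (Nat.lt_add_one i) h
        have h₂ := hle _ _ h
        simp only at *
        omega)
      (fun h => by
        have h₁ := T.row_weak (Nat.lt_add_one j) h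
        have h₂ := hle _ _ h
        have h₃ := hu _ h
        simp at *
        omega)
    obtain ⟨h₁, h₂⟩ := le_and_card_of_cells_eq_erase hc hκ
    refine ⟨κ, by simp only [mem_filter, mem_ofCard]; exact ⟨by omega, h₁⟩, hT, fun d hd hd' => ?_⟩
    rw [mem_iff_of_cells_eq_erase hκ] at hd'
    have : d = (i, j) := by tauto
    rw [this]
    exact hTc
  rw [← sum_congr rfl hF, hU]
  have hfin : ∀ κ, (F κ).Finite := fun κ => (finite_standardTableaux lam (n + 1)).sep _
  rw [Set.ncard_eq_toFinset_card _ (hU ▸ finite_standardTableaux lam (n + 1))]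
  simp_rw [fun κ => Set.ncard_eq_toFinset_card _ (hfin κ)]
  rw [← card_biUnion]
  · congr 1
    ext T
    simp
  · intro κ hk κ' hk' hne
    rw [Function.onFun, Finset.disjoint_left]
    intro T hT hT'
    rw [Set.Finite.mem_toFinset] at hT hT'
    simp only [mem_coe, mem_filter, mem_ofCard] at hk hk'
    obtain ⟨c, hc, h⟩ := exists_insert_of_le hk.2 (by omega)
    obtain ⟨c', hc', h'⟩ := exists_insert_of_le hk'.2 (by omega)
    obtain ⟨e, -, -, hu⟩ := huniq T hT.1
    have h₁ := (mem_iff_of_cells_eq_insert h c).2 (Or.inl rfl)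
    have h₂ := (mem_iff_of_cells_eq_insert h' c').2 (Or.inl rfl)
    have hcc : c = c' := (hu c h₁ (hT.2 c h₁ hc)).trans (hu c' h₂ (hT'.2 c' h₂ hc')).symm
    subst hcc
    refine hne (YoungDiagram.ext ?_)
    rw [← erase_insert (s := κ.cells) (a := c) (by simpa using hc), ← h, h',
      erase_insert (by simpa using hc')]

theorem ncard_standardTableaux_bot : (standardTableaux ⊥ 0).ncard = 1 := by
  rw [Set.ncard_eq_one]
  refine ⟨highestWeight ⊥, ?_⟩
  ext T
  simp only [Set.mem_singleton_iff]
  constructor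
  · intro _
    ext i j
    rw [zeros _ (notMem_bot _), zeros _ (notMem_bot _)]
  · rintro rfl k
    simp [ssytWeight]

open Finset Classical in
theorem two_pow_mul_factorial_mul_sum_isThreshold (m : ℕ) :
    2 ^ m * m.factorial * ∑ lam ∈ ofCard (2 * m) with lam.IsThreshold,
      (standardTableaux lam lam.card).ncard = (2 * m).factorial := by
  induction m with
  | zero =>
    have : ({lam ∈ ofCard (2 * 0) | lam.IsThreshold} : Finset _) = {⊥} := by
      ext κ
      simp only [mem_filter, mem_ofCard, mem_singleton, mul_zero]
      rw [YoungDiagram.card, card_eq_zero, YoungDiagram.ext_iff, cells_bot]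
      refine ⟨fun h => h.1, fun h => ⟨h, fun i hi => ?_⟩⟩
      rw [← mem_cells, h] at hi
      simp at hi
    rw [this]
    simpa [YoungDiagram.card] using ncard_standardTableaux_bot
  | succ m ih =>
    have := sum_isThreshold_eq (f := fun lam => (standardTableaux lam lam.card).ncard)
      (fun n lam hl => by
        rw [mem_ofCard] at hl
        simp only [hl]
        rw [ncard_standardTableaux_succ hl]
        exact sum_congr rfl fun κ hk => by rw [mem_ofCard.1 (mem_filter.1 hk).1]) (2 * m)
    rw [show 2 * (m + 1) = 2 * m + 2 by ring, this, Nat.factorial_succ, Nat.factorial_succ,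
      Nat.factorial_succ, ← ih]
    ring

theorem two_pow_mul_factorial_mul_ncard_involutions (m : ℕ) :
    2 ^ m * m.factorial * {w : Equiv.Perm (Fin (2 * m)) | w * w = 1 ∧ ∀ i, w i ≠ i}.ncard =
      (2 * m).factorial := by
  have hset : {w : Equiv.Perm (Fin (2 * m)) | w * w = 1 ∧ ∀ i, w i ≠ i} =
      ({w | w.cycleType = Multiset.replicate m 2} : Finset (Equiv.Perm (Fin (2 * m)))) := by
    ext w
    have hsum := w.sum_cycleType
    simp only [Set.mem_ofPred_eq, Finset.coe_filter, Finset.mem_univ, true_and]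
    rw [← pow_two]
    constructor
    · rintro ⟨hw, hfix⟩
      have := Equiv.Perm.cycleType_of_pow_prime_eq_one hw
      have hsupp : w.support = Finset.univ := by
        ext i
        simpa using hfix i
      rw [this, hsupp] at hsum
      simp at hsum
      rw [this, show w.cycleType.card = m by omega]
    · intro hw
      refine ⟨Equiv.Perm.pow_prime_eq_one_iff.2 fun c hc => ?_, fun i => ?_⟩
      · rw [hw] at hc
        exact Multiset.eq_of_mem_replicate hc
      · have hsupp : w.support = Finset.univ := by
          rw [← Finset.card_eq_iff_eq_univ, ← hsum, hw]
          simp [mul_comm]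
        rw [← Equiv.Perm.mem_support, hsupp]
        exact Finset.mem_univ i
  rw [hset, Set.ncard_coe_finset]
  have := Equiv.Perm.card_of_cycleType_mul_eq (α := Fin (2 * m)) (Multiset.replicate m 2)
  rw [if_pos ⟨by simp [mul_comm], fun a ha => (Multiset.eq_of_mem_replicate ha).ge⟩] at this
  rcases Nat.eq_zero_or_pos m with rfl | hm
  · simpa using this
  · rw [Multiset.toFinset_replicate, if_neg hm.ne'] at this
    simp only [Fintype.card_fin, Multiset.sum_replicate, smul_eq_mul, mul_comm m 2, Nat.sub_self,
      Nat.factorial_zero, one_mul, Multiset.prod_replicate, Finset.prod_singleton,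
      Multiset.count_replicate_self] at this
    rw [← this]
    ring

/-- **Fixed-point-free involutions vs standard tableaux of threshold shape.**
The number of fixed-point-free involutions in `S_{2m}` equals the total number of standard
Young tableaux whose shape is a threshold partition of `2m`. -/
theorem fpf_involutions_card (m : ℕ) (hm : 0 < m) :
    Set.ncard {w : Equiv.Perm (Fin (2 * m)) | w * w = 1 ∧ ∀ i, w i ≠ i} =
      ∑ᶠ (lam : YoungDiagram) (_ : lam.card = 2 * m ∧ lam.IsThreshold),
        tabCard lam (fun _ : Fin (2 * m) => 1) := by
  classical
  have hfin : ∑ᶠ (lam : YoungDiagram) (_ : lam.card = 2 * m ∧ lam.IsThreshold),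
      tabCard lam (fun _ : Fin (2 * m) => 1) =
        ∑ lam ∈ ofCard (2 * m) with lam.IsThreshold, (standardTableaux lam lam.card).ncard := by
    rw [finsum_cond_eq_sum_of_cond_iff _ (t := {lam ∈ ofCard (2 * m) | lam.IsThreshold})
      (by simp)]
    refine Finset.sum_congr rfl fun lam hl => ?_
    rw [tabCard_one, mem_ofCard.1 (Finset.mem_filter.1 hl).1]
  rw [hfin]
  refine Nat.eq_of_mul_eq_mul_left (show 0 < 2 ^ m * m.factorial by positivity) ?_
  rw [two_pow_mul_factorial_mul_ncard_involutions, two_pow_mul_factorial_mul_sum_isThreshold]
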